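/- Let A, B : Matrix (Fin 5) (Fin 2) ℂ be matrices all of whose 2×2 minors are nonzero: P A i j ≠ 0 and P B i j ≠ 0 for all i ≠ j. Then the following are equivalent: (1) the five cross-ratio points of A and B in ℂP¹ coincide, i.e. (P A 1 3 * P A 2 4 : P A 1 4 * P A 2 3) = (P B 1 3 * P B 2 4 : P B 1 4 * P B 2 3), (P A 1 3 * P A 2 5 : P A 1 5 * P A 2 3) = (P B 1 3 * P B 2 5 : P B 1 5 * P B 2 3), (P A 1 4 * P A 2 5 : P A 1 5 * P A 2 4) = (P B 1 4 * P B 2 5 : P B 1 5 * P B 2 4), (P A 1 4 * P A 3 5 : P A 1 5 * P A 3 4) = (P B 1 4 * P B 3 5 : P B 1 5 * P B 3 4), and (P A 2 4 * P A 3 5 : P A 2 5 * P A 3 4) = (P B 2 4 * P B 3 5 : P B 2 5 * P B 3 4); (2) there exist t : Fin 5 → ℂˣ and an invertible matrix g : GL (Fin 2) ℂ such that B = Matrix.diagonal (fun i => (t i : ℂ)) * A * g. (The cross-ratio map gives a well-defined injection — an embedding — of the space of parameters F = W/(ℂˣ)⁵ of the main stratum of G_{5,2} into (ℂP¹)⁵.)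 -/

import Mathlib

open scoped LinearAlgebra.Projectivization

/-- The `2 × 2` minor (Plücker coordinate) `P^{ij}` of a `5 × 2` complex matrix on rows `i, j`. -/
def P (A : Matrix (Fin 5) (Fin 2) ℂ) (i j : Fin 5) : ℂ :=
  A i 0 * A j 1 - A i 1 * A j 0

/-- The point of the complex projective line with homogeneous coordinates `(a : b)`. -/
noncomputable def pt (a b : ℂ) (h : a ≠ 0 ∨ b ≠ 0) : ℙ ℂ (Fin 2 → ℂ) :=
  Projectivization.mk ℂ ![a, b] (fun hz => by
    rcases h with h | h
    · exact h (by simpa using congrFun hz 0)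
    · exact h (by simpa using congrFun hz 1))

theorem pt_eq_iff (a b c d : ℂ) (h : a ≠ 0 ∨ b ≠ 0) (h' : c ≠ 0 ∨ d ≠ 0) (ha : a ≠ 0) (hc : c ≠ 0) :
    pt a b h = pt c d h' ↔ a * d = b * c := by
  unfold pt
  rw [Projectivization.mk_eq_mk_iff']
  constructor
  · rintro ⟨u, hu⟩
    have h0 : u * c = a := by simpa using congrFun hu 0
    have h1 : u * d = b := by simpa using congrFun hu 1
    rw [← h0, ← h1]; ring
  · intro e
    refine ⟨a / c, ?_⟩
    ext i
    fin_cases i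
    · simp [hc]
    · simp only [Fin.mk_one, Pi.smul_apply, smul_eq_mul, Matrix.cons_val_one, Matrix.cons_val_fin_one]
      field_simp
      linear_combination e

theorem row_scale (A B : Matrix (Fin 5) (Fin 2) ℂ)
    (hA : ∀ i j, i ≠ j → P A i j ≠ 0) (hB : ∀ i j, i ≠ j → P B i j ≠ 0)
    (s0 s1 : ℂ) (hs1 : s1 ≠ 0) (k : Fin 5) (hk : 0 ≠ k)
    (E : s0 * P A 1 k * P B 0 k = s1 * P A 0 k * P B 1 k) :
    ∃ c : ℂˣ, ∀ j, B k j = c * (A k 0 * (A 1 1 * s0 * B 0 j - A 0 1 * s1 * B 1 j)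
      + A k 1 * (A 0 0 * s1 * B 1 j - A 1 0 * s0 * B 0 j)) := by
  have h1 := hA 0 k hk
  have h2 := hB 0 k hk
  have h3 := hB 0 1 (by decide)
  refine ⟨Units.mk0 (P B 0 k / (s1 * P A 0 k * P B 0 1)) (by positivity), fun j => ?_⟩
  rw [Units.val_mk0, div_mul_eq_mul_div, eq_div_iff (by positivity)]
  have key : B k j * P B 0 1 = - P B 1 k * B 0 j + P B 0 k * B 1 j := by
    fin_cases j <;> simp [P] <;> ring
  have key2 : (A k 0 * (A 1 1 * s0 * B 0 j - A 0 1 * s1 * B 1 j)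
      + A k 1 * (A 0 0 * s1 * B 1 j - A 1 0 * s0 * B 0 j))
      = - P A 1 k * s0 * B 0 j + P A 0 k * s1 * B 1 j := by
    simp only [P]; ring
  rw [key2]
  linear_combination s1 * P A 0 k * key + B 0 j * E

/-- Two `5 × 2` matrices with all `2 × 2` minors nonzero (i.e. two points of the main stratum
`W` of `G_{5,2}`) have the same five cross-ratio points in `ℂP¹` iff they differ by the action
of the torus `(ℂˣ)⁵` (rescaling the rows) and of `GL(2, ℂ)` (change of basis); i.e. the
cross-ratio map embeds the space of parameters `F = W/(ℂˣ)⁵` into `(ℂP¹)⁵`.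
(Rows are indexed `0,…,4` instead of `1,…,5`.) -/
theorem cross_ratio_embedding (A B : Matrix (Fin 5) (Fin 2) ℂ)
    (hA : ∀ i j, i ≠ j → P A i j ≠ 0) (hB : ∀ i j, i ≠ j → P B i j ≠ 0) :
    (pt (P A 0 2 * P A 1 3) (P A 0 3 * P A 1 2)
        (Or.inl (mul_ne_zero (hA 0 2 (by decide)) (hA 1 3 (by decide)))) =
      pt (P B 0 2 * P B 1 3) (P B 0 3 * P B 1 2)
        (Or.inl (mul_ne_zero (hB 0 2 (by decide)) (hB 1 3 (by decide)))) ∧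
     pt (P A 0 2 * P A 1 4) (P A 0 4 * P A 1 2)
        (Or.inl (mul_ne_zero (hA 0 2 (by decide)) (hA 1 4 (by decide)))) =
      pt (P B 0 2 * P B 1 4) (P B 0 4 * P B 1 2)
        (Or.inl (mul_ne_zero (hB 0 2 (by decide)) (hB 1 4 (by decide)))) ∧
     pt (P A 0 3 * P A 1 4) (P A 0 4 * P A 1 3)
        (Or.inl (mul_ne_zero (hA 0 3 (by decide)) (hA 1 4 (by decide)))) =
      pt (P B 0 3 * P B 1 4) (P B 0 4 * P B 1 3)
        (Or.inl (mul_ne_zero (hB 0 3 (by decide)) (hB 1 4 (by decide)))) ∧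
     pt (P A 0 3 * P A 2 4) (P A 0 4 * P A 2 3)
        (Or.inl (mul_ne_zero (hA 0 3 (by decide)) (hA 2 4 (by decide)))) =
      pt (P B 0 3 * P B 2 4) (P B 0 4 * P B 2 3)
        (Or.inl (mul_ne_zero (hB 0 3 (by decide)) (hB 2 4 (by decide)))) ∧
     pt (P A 1 3 * P A 2 4) (P A 1 4 * P A 2 3)
        (Or.inl (mul_ne_zero (hA 1 3 (by decide)) (hA 2 4 (by decide)))) =
      pt (P B 1 3 * P B 2 4) (P B 1 4 * P B 2 3)
        (Or.inl (mul_ne_zero (hB 1 3 (by decide)) (hB 2 4 (by decide))))) ↔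
    ∃ (t : Fin 5 → ℂˣ) (g : GL (Fin 2) ℂ),
      B = Matrix.diagonal (fun i => (t i : ℂ)) * A * (g : Matrix (Fin 2) (Fin 2) ℂ) := by
  constructor
  · rintro ⟨e1, e2, -⟩
    rw [pt_eq_iff _ _ _ _ _ _ (mul_ne_zero (hA _ _ (by decide)) (hA _ _ (by decide)))
      (mul_ne_zero (hB _ _ (by decide)) (hB _ _ (by decide)))] at e1 e2
    have a01 := hA 0 1 (by decide)
    have b01 := hB 0 1 (by decide)
    obtain ⟨s0, hs0⟩ : ∃ s, s = P B 1 2 * P A 0 2 := ⟨_, rfl⟩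
    obtain ⟨s1, hs1⟩ : ∃ s, s = P B 0 2 * P A 1 2 := ⟨_, rfl⟩
    have n0 : s0 ≠ 0 := hs0 ▸ mul_ne_zero (hB _ _ (by decide)) (hA _ _ (by decide))
    have n1 : s1 ≠ 0 := hs1 ▸ mul_ne_zero (hB _ _ (by decide)) (hA _ _ (by decide))
    have main : ∀ k, ∃ c : ℂˣ, ∀ j, B k j = c * (A k 0 * (A 1 1 * s0 * B 0 j - A 0 1 * s1 * B 1 j)
      + A k 1 * (A 0 0 * s1 * B 1 j - A 1 0 * s0 * B 0 j)) := by
      intro k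
      by_cases hk : 0 = k
      · subst hk
        refine ⟨Units.mk0 (1 / (P A 0 1 * s0)) (one_div_ne_zero (mul_ne_zero a01 n0)), fun j => ?_⟩
        rw [Units.val_mk0, div_mul_eq_mul_div, eq_div_iff (by positivity)]
        simp only [P]; ring
      · refine row_scale A B hA hB s0 s1 n1 k hk ?_
        rw [hs0, hs1]
        fin_cases k
        · exact absurd rfl hk
        · simp only [Fin.mk_one, P]; ring
        · simp only [Fin.reduceFinMk]; ring
        · simp only [Fin.reduceFinMk]; linear_combination e1
        · simp only [Fin.reduceFinMk]; linear_combination e2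
    choose t ht using main
    refine ⟨t, Matrix.GeneralLinearGroup.mkOfDetNeZero
      (!![A 1 1 * s0 * B 0 0 - A 0 1 * s1 * B 1 0, A 1 1 * s0 * B 0 1 - A 0 1 * s1 * B 1 1;
        A 0 0 * s1 * B 1 0 - A 1 0 * s0 * B 0 0, A 0 0 * s1 * B 1 1 - A 1 0 * s0 * B 0 1]) ?_, ?_⟩
    · have : P A 0 1 * P B 0 1 * s0 * s1 ≠ 0 := by positivity
      rw [Matrix.det_fin_two_of]
      convert this using 1
      simp only [P]; ring
    · ext k j
      rw [Matrix.mul_assoc, Matrix.diagonal_mul, ht k j]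
      fin_cases j <;>
        simp [Matrix.mul_apply, Fin.sum_univ_two, Matrix.GeneralLinearGroup.mkOfDetNeZero]
  · rintro ⟨t, g, hg⟩
    have hP : ∀ i j, P B i j = t i * t j * (g 0 0 * g 1 1 - g 0 1 * g 1 0) * P A i j := by
      intro i j
      have hb : ∀ i j, B i j = t i * (A i 0 * g 0 j + A i 1 * g 1 j) := by
        intro i j
        rw [hg, Matrix.mul_assoc, Matrix.diagonal_mul, Matrix.mul_apply, Fin.sum_univ_two]
      simp only [P, hb]; ring
    refine ⟨?_, ?_, ?_, ?_, ?_⟩ <;>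
    · rw [pt_eq_iff _ _ _ _ _ _ (mul_ne_zero (hA _ _ (by decide)) (hA _ _ (by decide)))
        (mul_ne_zero (hB _ _ (by decide)) (hB _ _ (by decide)))]
      simp only [hP]; ring
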